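/- arXiv:2108.08558 — 2 statements merged into one kernel-verified Lean document; each statement's English description precedes it below -/
import Mathlib

section
/- Let G be 3-edge-connected with DFS tree T rooted at r, and let v ≠ r be a proper ancestor of a vertex u. If there exists a back-edge e such that B(v) = B(u) ⊔ {e} or B(u) = B(v) ⊔ {e} (disjoint union), then {(u,p(u)), (v,p(v)), e} is a 3-cut of G. -/
/-- An undirected multigraph `G` (parallel edges allowed, no self-loops) together with a
DFS spanning tree `T` rooted at `root`, where the vertices are identified with their DFS
preorder numbers (so they are `Fin n`, and the root gets the smallest number).
Tree edges are oriented from child to parent and back-edges from descendant to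
(proper) ancestor. -/
structure DFSGraph where
  /-- number of vertices; the vertices are `Fin n`, numbered in DFS preorder -/
  n : ℕ
  /-- the type indexing the edges (parallel edges are allowed) -/
  Edge : Type
  edgeFintype : Fintype Edge
  /-- the first endpoint (the descendant end) of each edge -/
  fst : Edge → Fin n
  /-- the second endpoint (the ancestor end) of each edge -/
  snd : Edge → Fin n
  /-- no self-loops -/
  noloop : ∀ e, fst e ≠ snd e
  /-- the root `r` of the DFS tree -/
  root : Fin n
  /-- in DFS preorder the root gets the smallest number -/
  root_le : ∀ v, root ≤ v
  /-- the parent function `p` of the DFS tree (arbitrary at the root) -/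
  parent : Fin n → Fin n
  /-- the parent of a non-root vertex precedes it in preorder -/
  parent_lt : ∀ v, v ≠ root → parent v < v
  /-- `tEdge v` is the tree edge `(v, p(v))`, for `v ≠ root` -/
  tEdge : Fin n → Edge
  tEdge_fst : ∀ v, v ≠ root → fst (tEdge v) = v
  tEdge_snd : ∀ v, v ≠ root → snd (tEdge v) = parent v
  tEdge_inj : ∀ u v, u ≠ root → v ≠ root → tEdge u = tEdge v → u = v
  /-- DFS property: every non-tree edge is a back-edge, i.e. it joins a vertex to an
  ancestor of it (a proper ancestor, by `noloop`) -/
  back_anc : ∀ e, (¬ ∃ v, v ≠ root ∧ e = tEdge v) →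
    Relation.ReflTransGen (fun x y => x ≠ root ∧ y = parent x) (fst e) (snd e)
  /-- preorder property: the descendants of any vertex form an interval of preorder
  numbers starting at that vertex -/
  preorder_interval : ∀ v u w : Fin n, v ≤ u → u ≤ w →
    Relation.ReflTransGen (fun x y => x ≠ root ∧ y = parent x) w v →
    Relation.ReflTransGen (fun x y => x ≠ root ∧ y = parent x) u v

namespace DFSGraph

variable (G : DFSGraph)

/-- `Anc a b`: `a` is an ancestor of `b` in `T` (every vertex is an ancestor of itself). -/
def Anc (a b : Fin G.n) : Prop :=
  Relation.ReflTransGen (fun x y => x ≠ G.root ∧ y = G.parent x) b a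

/-- `PAnc a b`: `a` is a proper ancestor of `b` in `T`. -/
def PAnc (a b : Fin G.n) : Prop := G.Anc a b ∧ a ≠ b

/-- `e` is an edge of the spanning tree `T`. -/
def IsTreeEdge (e : G.Edge) : Prop := ∃ v, v ≠ G.root ∧ e = G.tEdge v

/-- `e` is a back-edge (an edge of `G ∖ T`). -/
def IsBack (e : G.Edge) : Prop := ¬ G.IsTreeEdge e

/-- `B v`: the set of back-edges `(x, y)` with `x` a descendant of `v` and `y` a proper
ancestor of `v`. -/
def B (v : Fin G.n) : Set G.Edge :=
  {e | G.IsBack e ∧ G.Anc v (G.fst e) ∧ G.PAnc (G.snd e) v}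

/-- `b_count(v) = |B(v)|`. -/
noncomputable def bcount (v : Fin G.n) : ℕ := (G.B v).ncard

/-- adjacency in `G` after removing the edge set `S` -/
def AdjOff (S : Set G.Edge) (x y : Fin G.n) : Prop :=
  ∃ e, e ∉ S ∧ ((G.fst e = x ∧ G.snd e = y) ∨ (G.fst e = y ∧ G.snd e = x))

/-- `G ∖ S` is connected -/
def ConnectedOff (S : Set G.Edge) : Prop :=
  ∀ x y, Relation.ReflTransGen (G.AdjOff S) x y

/-- `S` is an edge cut of `G`: removing `S` disconnects `G`. -/
def IsCut (S : Set G.Edge) : Prop := ¬ G.ConnectedOff S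

/-- `G` is `k`-edge-connected: it has no cut of fewer than `k` edges. -/
def EdgeConn (k : ℕ) : Prop := ∀ S : Set G.Edge, S.ncard < k → ¬ G.IsCut S

/-- `IsLow1 v y`: `y = low1(v) = min {y | ∃ (x,y) ∈ B(v)}`. -/
def IsLow1 (v y : Fin G.n) : Prop :=
  (∃ e ∈ G.B v, G.snd e = y) ∧ ∀ e ∈ G.B v, y ≤ G.snd e

/-- `IsHigh v y`: `y = high(v) = max {y | ∃ (x,y) ∈ B(v)}`. -/
def IsHigh (v y : Fin G.n) : Prop :=
  (∃ e ∈ G.B v, G.snd e = y) ∧ ∀ e ∈ G.B v, G.snd e ≤ y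

/-- `IsLow2 v y`: `y = low2(v)`, the minimum lower end of the back-edges in `B(v)` minus
one (fixed, but arbitrary) back-edge `(low1D(v), low1(v))` attaining `low1(v)`. -/
def IsLow2 (v y : Fin G.n) : Prop :=
  ∃ f ∈ G.B v, (∀ g ∈ G.B v, G.snd f ≤ G.snd g) ∧
    (∃ e ∈ G.B v, e ≠ f ∧ G.snd e = y) ∧
    (∀ e ∈ G.B v, e ≠ f → y ≤ G.snd e)

/-- `IsL1 v y`: `y = l1(v) = min ({y | (v,y) is a back-edge} ∪ {v})`. -/
def IsL1 (v y : Fin G.n) : Prop :=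
  (y = v ∨ ∃ e, G.IsBack e ∧ G.fst e = v ∧ G.snd e = y) ∧
  y ≤ v ∧ (∀ e, G.IsBack e → G.fst e = v → y ≤ G.snd e)

/-- `IsL2 v y`: `y = l2(v)`, defined as `l1(v)` but after removing one (fixed, but
arbitrary) back-edge `(v, l1(v))` attaining `l1(v)`, if such a back-edge exists. -/
def IsL2 (v y : Fin G.n) : Prop :=
  ((¬ ∃ e, G.IsBack e ∧ G.fst e = v) ∧ y = v) ∨
  (∃ f, G.IsBack f ∧ G.fst f = v ∧
    (∀ g, G.IsBack g → G.fst g = v → G.snd f ≤ G.snd g) ∧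
    (y = v ∨ ∃ e, G.IsBack e ∧ G.fst e = v ∧ e ≠ f ∧ G.snd e = y) ∧
    y ≤ v ∧
    (∀ e, G.IsBack e → G.fst e = v → e ≠ f → y ≤ G.snd e))

/-- `z` is the nearest common ancestor of the set of vertices `S`. -/
def IsNCA (S : Set (Fin G.n)) (z : Fin G.n) : Prop :=
  (∀ x ∈ S, G.Anc z x) ∧ ∀ z', (∀ x ∈ S, G.Anc z' x) → G.Anc z' z

/-- `IsM v m`: `m = M(v)`, the nearest common ancestor of all higher ends of back-edges
in `B(v)`. -/
def IsM (v m : Fin G.n) : Prop :=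
  G.IsNCA {x | ∃ e ∈ G.B v, G.fst e = x} m

/-- `IsMtilde v m`: `m = M̃(v)`, the nearest common ancestor of all higher ends of
back-edges in `B(v)` that are proper descendants of `M(v)` (defined only if such a
higher end exists). -/
def IsMtilde (v m : Fin G.n) : Prop :=
  ∃ mv, G.IsM v mv ∧
    {x | ∃ e ∈ G.B v, G.fst e = x ∧ G.PAnc mv x}.Nonempty ∧
    G.IsNCA {x | ∃ e ∈ G.B v, G.fst e = x ∧ G.PAnc mv x} m

/-- `c` is a child of `p` in `T`. -/
def IsChild (p c : Fin G.n) : Prop := c ≠ G.root ∧ G.parent c = p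

/-- `low1(c) ≤ low1(c')` (stated relationally). -/
def Low1LE (c c' : Fin G.n) : Prop :=
  ∀ y y', G.IsLow1 c y → G.IsLow1 c' y' → y ≤ y'

/-- `c = c₁(p)`: `c` is a `low1` child of `p`, i.e. a child of `p` minimizing `low1`. -/
def IsC1 (p c : Fin G.n) : Prop :=
  G.IsChild p c ∧ ∀ c', G.IsChild p c' → G.Low1LE c c'

/-- `c = c₂(p)`: `c` is a `low2` child of `p`, i.e. a child of `p` minimizing `low1`
among the children different from the (fixed) `low1` child. -/
def IsC2 (p c : Fin G.n) : Prop :=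
  ∃ c1, G.IsC1 p c1 ∧ G.IsChild p c ∧ c ≠ c1 ∧
    ∀ c', G.IsChild p c' → c' ≠ c1 → G.Low1LE c c'

/-- `c = c₃(p)`: `c` is a `low3` child of `p`. -/
def IsC3 (p c : Fin G.n) : Prop :=
  ∃ c1 c2, G.IsC1 p c1 ∧
    (G.IsChild p c2 ∧ c2 ≠ c1 ∧ ∀ c', G.IsChild p c' → c' ≠ c1 → G.Low1LE c2 c') ∧
    G.IsChild p c ∧ c ≠ c1 ∧ c ≠ c2 ∧
    (∀ c', G.IsChild p c' → c' ≠ c1 → c' ≠ c2 → G.Low1LE c c')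

/-- `IsMlow1 v m`: `m = M_low1(v)`, the nearest common ancestor of all higher ends of
back-edges in `B(v)` that are descendants of the `low1` child of `M(v)` (defined only
if such a higher end exists). -/
def IsMlow1 (v m : Fin G.n) : Prop :=
  ∃ mv c1, G.IsM v mv ∧ G.IsC1 mv c1 ∧
    {x | ∃ e ∈ G.B v, G.fst e = x ∧ G.Anc c1 x}.Nonempty ∧
    G.IsNCA {x | ∃ e ∈ G.B v, G.fst e = x ∧ G.Anc c1 x} m

/-- `IsMlow2 v m`: `m = M_low2(v)`, the nearest common ancestor of all higher ends of
back-edges in `B(v)` that are descendants of the `low2` child of `M(v)` (defined only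
if such a higher end exists). -/
def IsMlow2 (v m : Fin G.n) : Prop :=
  ∃ mv c2, G.IsM v mv ∧ G.IsC2 mv c2 ∧
    {x | ∃ e ∈ G.B v, G.fst e = x ∧ G.Anc c2 x}.Nonempty ∧
    G.IsNCA {x | ∃ e ∈ G.B v, G.fst e = x ∧ G.Anc c2 x} m

/-- `IsNextM v w`: `w = nextM(v)`, the maximum vertex `w < v` with `M(w) = M(v)`. -/
def IsNextM (v w : Fin G.n) : Prop :=
  ∃ m, G.IsM v m ∧ G.IsM w m ∧ w < v ∧ ∀ w', w' < v → G.IsM w' m → w' ≤ w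

/-- `IsLowM v l`: `l = low_M(v) = min {y | ∃ (x,y) ∈ B(v) ∖ B(nextM(v))}`. -/
def IsLowM (v l : Fin G.n) : Prop :=
  ∃ w, G.IsNextM v w ∧ (∃ e ∈ G.B v, e ∉ G.B w ∧ G.snd e = l) ∧
    ∀ e ∈ G.B v, e ∉ G.B w → l ≤ G.snd e

end DFSGraph
namespace DFSGraph

variable {G : DFSGraph}

theorem Anc.le {a b : Fin G.n} (h : G.Anc a b) : a ≤ b := by
  induction h with
  | refl => exact le_rfl
  | tail _ hxy ih =>
    obtain ⟨hx, rfl⟩ := hxy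
    exact (G.parent_lt _ hx).le.trans ih

theorem Anc.trans {a b c : Fin G.n} (hab : G.Anc a b) (hbc : G.Anc b c) : G.Anc a c :=
  Relation.ReflTransGen.trans hbc hab

theorem Anc.ne_root_and_parent {a b : Fin G.n} (h : G.Anc a b) (hne : a ≠ b) :
    b ≠ G.root ∧ G.Anc a (G.parent b) := by
  rcases Relation.ReflTransGen.cases_head h with rfl | ⟨c, ⟨hb, rfl⟩, hc⟩
  · exact absurd rfl hne
  · exact ⟨hb, hc⟩

theorem Anc.total {a b c : Fin G.n} (hac : G.Anc a c) (hbc : G.Anc b c) :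
    G.Anc a b ∨ G.Anc b a := by
  rcases le_total a b with h | h
  · exact .inl (G.preorder_interval a b c h hbc.le hac)
  · exact .inr (G.preorder_interval b a c h hac.le hbc)

theorem anc_parent_iff {a w : Fin G.n} (hw : w ≠ G.root) (hne : a ≠ w) :
    G.Anc a (G.parent w) ↔ G.Anc a w :=
  ⟨fun h => h.trans (Relation.ReflTransGen.single ⟨hw, rfl⟩),
    fun h => (h.ne_root_and_parent hne).2⟩

theorem mem_B_iff {f : G.Edge} (hf : G.IsBack f) (w : Fin G.n) :
    f ∈ G.B w ↔ G.Anc w (G.fst f) ∧ ¬ G.Anc w (G.snd f) := by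
  constructor
  · rintro ⟨-, h1, h2, h3⟩
    exact ⟨h1, fun h => h3 (le_antisymm h2.le h.le)⟩
  · rintro ⟨h1, h2⟩
    refine ⟨hf, h1, ?_, fun h => h2 (h ▸ Relation.ReflTransGen.refl)⟩
    exact (h1.total (G.back_anc f hf)).resolve_left h2

theorem anc_fst_of_anc_snd {f : G.Edge} (hf : G.IsBack f) {w : Fin G.n}
    (h : G.Anc w (G.snd f)) : G.Anc w (G.fst f) :=
  h.trans (G.back_anc f hf)

/-- A set of vertices whose boundary lies in `S` witnesses that `S` is a cut. -/
theorem isCut_of_separates {S : Set G.Edge} (X : Fin G.n → Prop) {a b : Fin G.n}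
    (ha : X a) (hb : ¬ X b) (hX : ∀ f, f ∉ S → (X (G.fst f) ↔ X (G.snd f))) :
    G.IsCut S := by
  intro hconn
  have key : ∀ c, Relation.ReflTransGen (G.AdjOff S) a c → X c := by
    intro c hc
    induction hc with
    | refl => exact ha
    | tail _ hxy ih =>
      obtain ⟨f, hf, ⟨rfl, rfl⟩ | ⟨rfl, rfl⟩⟩ := hxy
      · exact (hX f hf).1 ih
      · exact (hX f hf).2 ih
  exact hb (key b (hconn a b))

end DFSGraph

/-- Lemma 3.1, converse direction: Let `G` be `3`-edge-connected with
DFS tree `T` rooted at `r`, and let `v ≠ r` be a proper ancestor of a vertex `u`. If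
there exists a back-edge `e` with `B(v) = B(u) ⊔ {e}` or `B(u) = B(v) ⊔ {e}` (disjoint
union), then `{(u,p(u)), (v,p(v)), e}` is a `3`-cut of `G`. -/
theorem stmt3 (G : DFSGraph) (h3 : G.EdgeConn 3) (u v : Fin G.n)
    (hv : v ≠ G.root) (hanc : G.PAnc v u)
    (e : G.Edge) (he : G.IsBack e)
    (hdu : (G.B v = insert e (G.B u) ∧ e ∉ G.B u) ∨
           (G.B u = insert e (G.B v) ∧ e ∉ G.B v)) :
    G.IsCut {G.tEdge u, G.tEdge v, e} ∧
      ({G.tEdge u, G.tEdge v, e} : Set G.Edge).ncard = 3 := by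
  obtain ⟨hvu, hne⟩ := hanc
  have hu : u ≠ G.root := (hvu.ne_root_and_parent hne).1
  constructor
  · refine DFSGraph.isCut_of_separates (fun w => G.Anc v w ∧ ¬ G.Anc u w) (a := v) (b := G.root)
      ⟨Relation.ReflTransGen.refl, fun h => hne (le_antisymm hvu.le h.le)⟩
      (fun h => hv (le_antisymm h.1.le (G.root_le v))) ?_
    intro f hf
    simp only [Set.mem_insert_iff, Set.mem_singleton_iff, not_or] at hf
    obtain ⟨hfu, hfv, hfe⟩ := hf
    by_cases hb : G.IsBack f
    · have hB : f ∈ G.B v ↔ f ∈ G.B u := by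
        rcases hdu with ⟨h, -⟩ | ⟨h, -⟩ <;> simp [h, hfe]
      rw [DFSGraph.mem_B_iff hb, DFSGraph.mem_B_iff hb] at hB
      have h1 := DFSGraph.anc_fst_of_anc_snd hb (w := u)
      have h2 := DFSGraph.anc_fst_of_anc_snd hb (w := v)
      have h4 : G.Anc u (G.snd f) → G.Anc v (G.snd f) := hvu.trans
      tauto
    · obtain ⟨w, hw, rfl⟩ := not_not.1 hb
      have hwu : u ≠ w := fun h => hfu (h ▸ rfl)
      have hwv : v ≠ w := fun h => hfv (h ▸ rfl)
      simp only [G.tEdge_fst w hw, G.tEdge_snd w hw, DFSGraph.anc_parent_iff hw hwu,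
        DFSGraph.anc_parent_iff hw hwv]
  · exact Set.ncard_eq_three.2 ⟨_, _, _, fun h => hne (G.tEdge_inj u v hu hv h).symm,
      fun h => he ⟨u, hu, h.symm⟩, fun h => he ⟨v, hv, h.symm⟩, rfl⟩
end

section
/- Let G be 3-edge-connected with DFS tree T rooted at r. For any two distinct vertices u ≠ u', the sets V(u) and V(u') are disjoint; equivalently, for every vertex v ≠ r there is at most one descendant u of v for which there exists a back-edge e with B(v) = B(u) ⊔ {e}. -/
namespace DFSGraph

variable {G : DFSGraph}

theorem Anc.antisymm {a b : Fin G.n} (hab : G.Anc a b) (hba : G.Anc b a) : a = b :=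
  le_antisymm hab.le hba.le

theorem Anc.ne_root {a b : Fin G.n} (h : G.Anc a b) (ha : a ≠ G.root) : b ≠ G.root := by
  rintro rfl
  exact ha (le_antisymm h.le (G.root_le a))

theorem Anc.total_s4 {a b x : Fin G.n} (ha : G.Anc a x) (hb : G.Anc b x) :
    G.Anc a b ∨ G.Anc b a :=
  (Relation.ReflTransGen.total_of_right_unique
    (fun _ _ _ h h' => h.2.trans h'.2.symm) ha hb).symm

theorem anc_parent {v : Fin G.n} (hv : v ≠ G.root) : G.Anc (G.parent v) v :=
  Relation.ReflTransGen.single ⟨hv, rfl⟩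

theorem Anc.eq_or_anc_parent {a b : Fin G.n} (h : G.Anc a b) :
    a = b ∨ G.Anc a (G.parent b) := by
  rcases Relation.ReflTransGen.cases_head h with h | ⟨c, ⟨_, rfl⟩, h⟩
  · exact Or.inl h.symm
  · exact Or.inr h

theorem anc_snd_fst (e : G.Edge) : G.Anc (G.snd e) (G.fst e) := by
  by_cases he : G.IsTreeEdge e
  · obtain ⟨v, hv, rfl⟩ := he
    rw [G.tEdge_fst v hv, G.tEdge_snd v hv]
    exact anc_parent hv
  · exact G.back_anc e he

/-- The only edges leaving the subtree of `w` are its parent edge and the edges of `B w`. -/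
theorem anc_snd_of_anc_fst {w : Fin G.n} {e : G.Edge} (hT : e ≠ G.tEdge w) (hB : e ∉ G.B w)
    (h : G.Anc w (G.fst e)) : G.Anc w (G.snd e) := by
  by_cases he : G.IsTreeEdge e
  · obtain ⟨v, hv, rfl⟩ := he
    rw [G.tEdge_fst v hv] at h
    rw [G.tEdge_snd v hv]
    rcases h.eq_or_anc_parent with rfl | h
    · exact absurd rfl hT
    · exact h
  · rcases h.total_s4 (anc_snd_fst e) with h' | h'
    · exact h'
    · by_contra hn
      exact hB ⟨he, h, h', fun heq => hn (heq ▸ Relation.ReflTransGen.refl)⟩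

theorem isCut_of_forall_iff {S : Set G.Edge} (P : Fin G.n → Prop) {x y : Fin G.n}
    (hP : ∀ e, e ∉ S → (P (G.fst e) ↔ P (G.snd e))) (hx : P x) (hy : ¬ P y) :
    G.IsCut S := by
  intro hconn
  have key : ∀ z, Relation.ReflTransGen (G.AdjOff S) x z → P z := by
    intro z hz
    induction hz with
    | refl => exact hx
    | tail _ h ih =>
      obtain ⟨e, he, ⟨rfl, rfl⟩ | ⟨rfl, rfl⟩⟩ := h
      · exact (hP e he).1 ih
      · exact (hP e he).2 ih
  exact hy (key y (hconn x y))

theorem not_anc_root {w : Fin G.n} (hw : w ≠ G.root) : ¬ G.Anc w G.root :=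
  fun h => h.ne_root hw rfl

theorem isCut_insert_tEdge_B {w : Fin G.n} (hw : w ≠ G.root) :
    G.IsCut (insert (G.tEdge w) (G.B w)) := by
  refine isCut_of_forall_iff (G.Anc w) (x := w) (fun e he => ?_)
    Relation.ReflTransGen.refl (not_anc_root hw)
  rw [Set.mem_insert_iff, not_or] at he
  exact ⟨anc_snd_of_anc_fst he.1 he.2, fun h => h.trans (anc_snd_fst e)⟩

theorem isCut_tEdge_pair {u w : Fin G.n} (hu : u ≠ G.root) (huw : G.Anc u w) (hne : u ≠ w)
    (hB : G.B u = G.B w) : G.IsCut {G.tEdge u, G.tEdge w} := by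
  refine isCut_of_forall_iff (fun x => G.Anc u x ∧ ¬ G.Anc w x) (x := u) (fun e he => ?_)
    ⟨Relation.ReflTransGen.refl, fun h => hne (huw.antisymm h)⟩
    (fun h => not_anc_root hu h.1)
  rw [Set.mem_insert_iff, Set.mem_singleton_iff, not_or] at he
  by_cases heB : e ∈ G.B u
  · have hw : e ∈ G.B w := hB ▸ heB
    exact ⟨fun h => absurd hw.2.1 h.2,
      fun h => absurd (heB.2.2.1.antisymm h.1) heB.2.2.2⟩
  · have hw : e ∉ G.B w := hB ▸ heB
    exact ⟨fun h => ⟨anc_snd_of_anc_fst he.1 heB h.1, fun h' => h.2 (h'.trans (anc_snd_fst e))⟩,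
      fun h => ⟨h.1.trans (anc_snd_fst e), fun h' => h.2 (anc_snd_of_anc_fst he.2 hw h')⟩⟩

theorem EdgeConn.two_le_ncard_B (h3 : G.EdgeConn 3) {w : Fin G.n} (hw : w ≠ G.root) :
    2 ≤ (G.B w).ncard := by
  by_contra! h
  refine h3 _ ?_ (isCut_insert_tEdge_B hw)
  have := Set.ncard_insert_le (G.tEdge w) (G.B w)
  lia

theorem EdgeConn.eq_of_B_eq (h3 : G.EdgeConn 3) {u w : Fin G.n} (hu : u ≠ G.root)
    (huw : G.Anc u w) (hB : G.B u = G.B w) : u = w := by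
  by_contra hne
  refine h3 _ ?_ (isCut_tEdge_pair hu huw hne hB)
  have := Set.ncard_insert_le (G.tEdge u) {G.tEdge w}
  rw [Set.ncard_singleton] at this
  lia

/-- An edge of `B w` that leaves the subtree of `v` also leaves every subtree in between. -/
theorem B_subset_B_of_anc {v u w : Fin G.n} (hvu : G.Anc v u) (huw : G.Anc u w)
    (h : G.B w ⊆ G.B v) : G.B w ⊆ G.B u := by
  intro e he
  have hev := h he
  exact ⟨he.1, huw.trans he.2.1, hev.2.2.1.trans hvu,
    fun heq => hev.2.2.2 (hev.2.2.1.antisymm (heq ▸ hvu))⟩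

end DFSGraph

/-- Let `G` be `3`-edge-connected with DFS tree `T` rooted at `r`. For
any two distinct vertices `u ≠ u'` the sets `V(u)` and `V(u')` are disjoint;
equivalently, for every vertex `v ≠ r` there is at most one descendant `u` of `v` for
which there exists a back-edge `e` with `B(v) = B(u) ⊔ {e}`. -/
theorem stmt4 (G : DFSGraph) (h3 : G.EdgeConn 3) (v u u' : Fin G.n)
    (hv : v ≠ G.root)
    (h1 : G.Anc v u ∧ ∃ e, G.IsBack e ∧ e ∉ G.B u ∧ G.B v = insert e (G.B u))
    (h2 : G.Anc v u' ∧ ∃ e, G.IsBack e ∧ e ∉ G.B u' ∧ G.B v = insert e (G.B u')) :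
    u = u' := by
  have : Finite G.Edge := @Finite.of_fintype _ G.edgeFintype
  obtain ⟨hvu, e, _, he, hBu⟩ := h1
  obtain ⟨hvu', e', _, he', hBu'⟩ := h2
  have hu : u ≠ G.root := hvu.ne_root hv
  have hu' : u' ≠ G.root := hvu'.ne_root hv
  have hsub : G.B u ⊆ G.B v := hBu ▸ Set.subset_insert e _
  have hsub' : G.B u' ⊆ G.B v := hBu' ▸ Set.subset_insert e' _
  have hcard : (G.B v).ncard = (G.B u).ncard + 1 := by
    rw [hBu, Set.ncard_insert_of_notMem he]
  have hcard' : (G.B v).ncard = (G.B u').ncard + 1 := by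
    rw [hBu', Set.ncard_insert_of_notMem he']
  have hanc : G.Anc u u' ∨ G.Anc u' u := by
    by_contra hn
    have hdisj : Disjoint (G.B u) (G.B u') :=
      Set.disjoint_left.2 fun f hf hf' => hn (hf.2.1.total_s4 hf'.2.1)
    have hunion := Set.ncard_union_eq hdisj
    have hle := Set.ncard_le_ncard (Set.union_subset hsub hsub')
    have := h3.two_le_ncard_B hu
    have := h3.two_le_ncard_B hu'
    lia
  rcases hanc with h | h
  · exact h3.eq_of_B_eq hu h (Set.eq_of_subset_of_ncard_le
      (DFSGraph.B_subset_B_of_anc hvu h hsub') (by lia)).symm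
  · exact (h3.eq_of_B_eq hu' h (Set.eq_of_subset_of_ncard_le
      (DFSGraph.B_subset_B_of_anc hvu' h hsub) (by lia)).symm).symm
end
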